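/- If P is a minimal representation-infinite ray category, then for any field k the category of finite-dimensional k(P)-modules contains no nonzero module that is both projective and injective. -/

import Mathlib

set_option autoImplicit false

/-- A ray category (Bautista–Gabriel–Roiter–Salmerón).  The fields `pipow x`
record the powers of the generator `π(x)` of the radical of `P(x,x)`. -/
structure RayCategory : Type 1 where
  Obj : Type
  Hom : Obj → Obj → Type
  id : ∀ x : Obj, Hom x x
  comp : ∀ {x y z : Obj}, Hom y z → Hom x y → Hom x z
  zero : ∀ x y : Obj, Hom x y
  comp_id : ∀ {x y : Obj} (f : Hom x y), comp f (id x) = f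
  id_comp : ∀ {x y : Obj} (f : Hom x y), comp (id y) f = f
  assoc : ∀ {x y z w : Obj} (h : Hom z w) (g : Hom y z) (f : Hom x y),
      comp (comp h g) f = comp h (comp g f)
  /-- axiom b : zero morphisms -/
  zero_comp : ∀ {x y z : Obj} (f : Hom x y), comp (zero y z) f = zero x z
  comp_zero : ∀ {x y z : Obj} (f : Hom y z), comp f (zero x y) = zero x z
  /-- axiom a : the objects are pairwise non-isomorphic -/
  no_iso : ∀ {x y : Obj} (f : Hom x y) (g : Hom y x),
      comp g f = id x → comp f g = id y → x = y
  /-- axiom c : local finiteness -/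
  finite_target : ∀ x : Obj, {y : Obj | ∃ f : Hom x y, f ≠ zero x y}.Finite
  finite_source : ∀ x : Obj, {y : Obj | ∃ f : Hom y x, f ≠ zero y x}.Finite
  /-- the powers of the generator `π(x)` of `P(x,x)`; `pipow x 1 = π(x)`. -/
  pipow : ∀ x : Obj, ℕ → Hom x x
  pipow_zero : ∀ x, pipow x 0 = id x
  pipow_succ : ∀ x n, pipow x (n + 1) = comp (pipow x 1) (pipow x n)
  nilp : Obj → ℕ
  nilp_pos : ∀ x, 1 ≤ nilp x
  /-- axiom d : `P(x,x) = {id, σ, …, σ^{n-1} ≠ 0 = σ^n}` -/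
  endo_cyclic : ∀ (x : Obj) (f : Hom x x), ∃ i : ℕ, f = pipow x i
  pipow_nilp : ∀ x, pipow x (nilp x) = zero x x
  pipow_nilp_ne : ∀ x, pipow x (nilp x - 1) ≠ zero x x
  /-- axiom e : `P(x,y)` is cyclic under the action of `P(x,x)` or of `P(y,y)` -/
  hom_cyclic : ∀ x y : Obj, ∃ g : Hom x y,
      (∀ f : Hom x y, ∃ i : ℕ, f = comp (pipow y i) g) ∨
      (∀ f : Hom x y, ∃ i : ℕ, f = comp g (pipow x i))
  /-- axiom f : cancellation -/
  cancel : ∀ {x y z w : Obj} (kappa : Hom x y) (mu nu : Hom y z) (lam : Hom z w),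
      comp lam (comp mu kappa) = comp lam (comp nu kappa) →
      comp lam (comp mu kappa) ≠ zero x w → mu = nu

namespace RayCategory

variable (P : RayCategory)

/-- the generator of the radical of `P(x,x)` -/
def pi (x : P.Obj) : P.Hom x x := P.pipow x 1

/-- powers of an endomorphism -/
def pow {x : P.Obj} (f : P.Hom x x) : ℕ → P.Hom x x
  | 0 => P.id x
  | n + 1 => P.comp f (pow f n)

/-- `f` is an identity morphism -/
def IsId {x y : P.Obj} (f : P.Hom x y) : Prop := ∃ _ : x = y, HEq f (P.id x)

/-- irreducible morphisms (= arrows of the quiver of `P`): nonzero morphisms which are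
not identities and cannot be written as a product of two non-identity morphisms -/
def IsIrreducible {x y : P.Obj} (f : P.Hom x y) : Prop :=
  f ≠ P.zero x y ∧ ¬ P.IsId f ∧
    ∀ (z : P.Obj) (g : P.Hom z y) (h : P.Hom x z), f = P.comp g h → P.IsId g ∨ P.IsId h

/-- irreducibility inside the full subcategory supported by `S` -/
def IsIrreducibleOn (S : Set P.Obj) {x y : P.Obj} (f : P.Hom x y) : Prop :=
  f ≠ P.zero x y ∧ ¬ P.IsId f ∧
    ∀ z ∈ S, ∀ (g : P.Hom z y) (h : P.Hom x z), f = P.comp g h → P.IsId g ∨ P.IsId h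

/-- the sub-bimodule `P(y,y) μ P(x,x)` of `P(x,y)` generated by `μ` -/
def Bimod {x y : P.Obj} (mu : P.Hom x y) : Set (P.Hom x y) :=
  {f | ∃ i j : ℕ, f = P.comp (P.pipow y i) (P.comp mu (P.pipow x j))}

/-- `μ` is transit : the sub-bimodule generated by `μ` is cyclic over `P(y,y)` -/
def IsTransit {x y : P.Obj} (mu : P.Hom x y) : Prop :=
  mu ≠ P.zero x y ∧
    ∃ g ∈ P.Bimod mu, ∀ f ∈ P.Bimod mu, ∃ i : ℕ, f = P.comp (P.pipow y i) g

/-- `μ` is cotransit : the sub-bimodule generated by `μ` is cyclic over `P(x,x)` -/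
def IsCotransit {x y : P.Obj} (mu : P.Hom x y) : Prop :=
  mu ≠ P.zero x y ∧
    ∃ g ∈ P.Bimod mu, ∀ f ∈ P.Bimod mu, ∃ j : ℕ, f = P.comp g (P.pipow x j)

/-- `μ` is deep : `π(y)μ = 0 = μπ(x)` -/
def IsDeep {x y : P.Obj} (mu : P.Hom x y) : Prop :=
  mu ≠ P.zero x y ∧ P.comp (P.pi y) mu = P.zero x y ∧ P.comp mu (P.pi x) = P.zero x y

/-- transport of a morphism along equalities of objects -/
def castHom {a b c d : P.Obj} (h1 : a = c) (h2 : b = d) (f : P.Hom a b) : P.Hom c d :=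
  cast (by rw [h1, h2]) f

/-- the composite `a_{i+j-1} ⋯ a_{i+1} a_i : x_i → x_{i+j}` of a chain of morphisms -/
def chain (x : ℕ → P.Obj) (a : ∀ i : ℕ, P.Hom (x i) (x (i + 1))) (i : ℕ) :
    ∀ j : ℕ, P.Hom (x i) (x (i + j))
  | 0 => P.id (x i)
  | j + 1 => P.comp (a (i + j)) (chain x a i j)

end RayCategory

/-- Paths in the quiver `Q_P` of a ray category `P` (the arrow `f` of `cons f hf p`
is the *last* arrow of the path). -/
inductive RPath (P : RayCategory) : P.Obj → P.Obj → Type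
  | nil (x : P.Obj) : RPath P x x
  | cons {x y z : P.Obj} (f : P.Hom y z) (hf : P.IsIrreducible f) (p : RPath P x y) :
      RPath P x z

namespace RPath

variable {P : RayCategory}

/-- the morphism `v⃗` of `P` obtained by composing the arrows of a path `v` -/
def toHom : ∀ {x y : P.Obj}, RPath P x y → P.Hom x y
  | _, _, .nil x => P.id x
  | _, _, .cons f _ p => P.comp f p.toHom

def length : ∀ {x y : P.Obj}, RPath P x y → ℕ
  | _, _, .nil _ => 0
  | _, _, .cons _ _ p => p.length + 1

/-- the set of points visited by a path -/
def points : ∀ {x y : P.Obj}, RPath P x y → Set P.Obj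
  | _, _, .nil x => {x}
  | _, _, @RPath.cons _ _ _ z _ _ p => insert z p.points

/-- concatenation of paths -/
def append : ∀ {x y z : P.Obj}, RPath P y z → RPath P x y → RPath P x z
  | _, _, _, .nil _, p => p
  | _, _, _, .cons f hf q, p => .cons f hf (q.append p)

/-- the arrow `g` occurs in the path -/
def HasArrow : ∀ {x y : P.Obj}, RPath P x y → ∀ {a b : P.Obj}, P.Hom a b → Prop
  | _, _, .nil _, _, _, _ => False
  | _, _, .cons f _ p, _, _, g => HEq f g ∨ p.HasArrow g

/-- one step of the interlacing relation: `v = p v' q`, `w = p w' q` with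
`v⃗' = w⃗' ≠ 0` and `p`, `q` not both identities -/
def InterlaceStep {x y : P.Obj} (v w : RPath P x y) : Prop :=
  ∃ (a b : P.Obj) (p : RPath P b y) (v' w' : RPath P a b) (q : RPath P x a),
    v = p.append (v'.append q) ∧ w = p.append (w'.append q) ∧
    v'.toHom = w'.toHom ∧ v'.toHom ≠ P.zero a b ∧ ¬ (p.length = 0 ∧ q.length = 0)

/-- two paths are interlaced if they lie in the transitive closure of the relation above -/
def Interlaced {x y : P.Obj} (v w : RPath P x y) : Prop :=
  Relation.TransGen (fun v' w' : RPath P x y => InterlaceStep v' w') v w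

end RPath

/-- a chain of arrows as a path -/
def pchain (P : RayCategory) (x : ℕ → P.Obj) (a : ∀ i : ℕ, P.Hom (x i) (x (i + 1)))
    (ha : ∀ i, P.IsIrreducible (a i)) (i : ℕ) : ∀ j : ℕ, RPath P (x i) (x (i + j))
  | 0 => .nil (x i)
  | j + 1 => .cons (a (i + j)) (ha (i + j)) (pchain P x a ha i j)

/-- A contour `C = {v,w}` of `P` from `x` to `y` : a pair of different, non-interlaced
paths with `v⃗ = w⃗ ≠ 0`. -/
structure Contour (P : RayCategory) (x y : P.Obj) : Type where
  v : RPath P x y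
  w : RPath P x y
  ne : v ≠ w
  hom_eq : v.toHom = w.toHom
  nz : v.toHom ≠ P.zero x y
  nint : ¬ RPath.Interlaced v w
/-- A module over the linearization `k(D/I)` of the quotient by the ideal generated by the
morphisms in `I` of the full subcategory of `P` supported by `D`:
a `k`-linear functor defined on the morphisms between points of `D`, vanishing on `I`.
For `D = Set.univ` and `I = fun _ _ _ => False` this is exactly a `k(P)`-module. -/
structure RMod (P : RayCategory) (k : Type) [Field k] (D : Set P.Obj)
    (I : ∀ a b : P.Obj, P.Hom a b → Prop) where
  M : P.Obj → Type
  [acg : ∀ x, AddCommGroup (M x)]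
  [mod : ∀ x, Module k (M x)]
  act : ∀ {x y : P.Obj}, P.Hom x y → (M x →ₗ[k] M y)
  act_id : ∀ x ∈ D, act (P.id x) = LinearMap.id
  act_comp : ∀ {x y z : P.Obj}, x ∈ D → y ∈ D → z ∈ D →
      ∀ (g : P.Hom y z) (f : P.Hom x y), act (P.comp g f) = (act g).comp (act f)
  act_zero : ∀ {x y : P.Obj}, x ∈ D → y ∈ D → act (P.zero x y) = 0
  supp : ∀ x : P.Obj, x ∉ D → ∀ m : M x, m = 0
  killed : ∀ {a b : P.Obj} (f : P.Hom a b), I a b f → act f = 0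

attribute [instance] RMod.acg RMod.mod

/-- morphisms of modules -/
structure RModHom {P : RayCategory} {k : Type} [Field k] {D : Set P.Obj}
    {I : ∀ a b : P.Obj, P.Hom a b → Prop} (M N : RMod P k D I) where
  app : ∀ x : P.Obj, M.M x →ₗ[k] N.M x
  natural : ∀ {x y : P.Obj} (f : P.Hom x y), (N.act f).comp (app x) = (app y).comp (M.act f)

/-- isomorphism of modules -/
def RModIso {P : RayCategory} {k : Type} [Field k] {D : Set P.Obj}
    {I : ∀ a b : P.Obj, P.Hom a b → Prop} (M N : RMod P k D I) : Prop :=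
  ∃ φ : RModHom M N, ∀ x, Function.Bijective (φ.app x)

namespace RMod

variable {P : RayCategory} {k : Type} [Field k] {D : Set P.Obj}
  {I : ∀ a b : P.Obj, P.Hom a b → Prop}

/-- finite-dimensional: the sum of the dimensions of all `M x` is finite -/
def FinDim (M : RMod P k D I) : Prop :=
  (∀ x, FiniteDimensional k (M.M x)) ∧ {x : P.Obj | ∃ m : M.M x, m ≠ 0}.Finite

def Nonzero (M : RMod P k D I) : Prop := ∃ x, ∃ m : M.M x, m ≠ 0

/-- indecomposable: nonzero, and the only idempotent endomorphisms are `0` and `id` -/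
def Indec (M : RMod P k D I) : Prop :=
  M.Nonzero ∧ ∀ e : RModHom M M, (∀ x, (e.app x).comp (e.app x) = e.app x) →
    (∀ x, e.app x = 0) ∨ (∀ x, e.app x = LinearMap.id)

end RMod

/-- the full subcategory supported by `D` of the quotient of `P` by the ideal generated
by `I` is (locally) representation-finite: for any field `k`, every point lies in the
support of only finitely many isomorphism classes of finite-dimensional indecomposables -/
def RepFin (P : RayCategory) (D : Set P.Obj) (I : ∀ a b : P.Obj, P.Hom a b → Prop) : Prop :=
  ∀ (k : Type) [Field k], ∀ x : P.Obj,
    ∃ (ι : Type) (_ : Finite ι) (rep : ι → RMod P k D I),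
      ∀ M : RMod P k D I, M.FinDim → M.Indec → (∃ m : M.M x, m ≠ 0) →
        ∃ i : ι, RModIso (rep i) M

/-- the trivial ideal -/
def RayCategory.noIdeal (P : RayCategory) : ∀ a b : P.Obj, P.Hom a b → Prop :=
  fun _ _ _ => False

/-- `P` is locally representation-finite -/
def LocRepFin (P : RayCategory) : Prop := RepFin P Set.univ P.noIdeal

/-- the ideal of `P` generated by the morphism `μ` -/
def IdealOf (P : RayCategory) {a b : P.Obj} (mu : P.Hom a b) :
    ∀ s t : P.Obj, P.Hom s t → Prop :=
  fun s t f => ∃ (g : P.Hom b t) (h : P.Hom s a), f = P.comp g (P.comp mu h)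

/-- an ideal of a ray category -/
structure RIdeal (P : RayCategory) where
  mem : ∀ a b : P.Obj, P.Hom a b → Prop
  zero_mem : ∀ a b : P.Obj, mem a b (P.zero a b)
  comp_mem_left : ∀ {a b c : P.Obj} (g : P.Hom b c) (f : P.Hom a b),
      mem a b f → mem a c (P.comp g f)
  comp_mem_right : ∀ {a b c : P.Obj} (g : P.Hom b c) (f : P.Hom a b),
      mem b c g → mem a c (P.comp g f)

/-- `P` is minimal representation-infinite: not locally representation-finite, but every
proper quotient (quotient by an ideal containing a nonzero morphism) is locally
representation-finite -/
def MinRepInfinite (P : RayCategory) : Prop :=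
  ¬ LocRepFin P ∧ ∀ J : RIdeal P,
    (∃ (a b : P.Obj) (f : P.Hom a b), f ≠ P.zero a b ∧ J.mem a b f) →
      RepFin P Set.univ J.mem

/-- support of the indecomposable projective module `P_x` over the quotient of `P` by `I` -/
def ProjSupp (P : RayCategory) (I : ∀ a b : P.Obj, P.Hom a b → Prop) (x : P.Obj) :
    Set P.Obj :=
  {y : P.Obj | ∃ f : P.Hom x y, f ≠ P.zero x y ∧ ¬ I x y f}

/-- support of the indecomposable injective module `I_y` over the quotient of `P` by `I` -/
def InjSupp (P : RayCategory) (I : ∀ a b : P.Obj, P.Hom a b → Prop) (y : P.Obj) :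
    Set P.Obj :=
  {z : P.Obj | ∃ f : P.Hom z y, f ≠ P.zero z y ∧ ¬ I z y f}

namespace Contour

variable {P : RayCategory} {x y : P.Obj} (C : Contour P x y)

/-- points of the contour = points of the full subcategory `P(C)` -/
def points : Set P.Obj := C.v.points ∪ C.w.points

/-- the contour is non-deep -/
def NonDeep : Prop := ¬ P.IsDeep C.v.toHom

/-- the ideal generated by `π(y)v⃗`, so that `P' = P/π(y)v⃗` (transit case) -/
def It : ∀ a b : P.Obj, P.Hom a b → Prop := IdealOf P (P.comp (P.pi y) C.v.toHom)

/-- the ideal generated by `v⃗π(x)` (cotransit case) -/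
def Ic : ∀ a b : P.Obj, P.Hom a b → Prop := IdealOf P (P.comp C.v.toHom (P.pi x))

/-- decisive subcategories of `P' = P/π(y)v⃗` for `C` (transit case) -/
def DecisiveT (D : Set P.Obj) : Prop :=
  x ∈ D ∧ y ∈ D ∧ D ⊆ ProjSupp P C.It x ∪ InjSupp P C.It y

/-- decisive subcategories (cotransit case) -/
def DecisiveC (D : Set P.Obj) : Prop :=
  x ∈ D ∧ y ∈ D ∧ D ⊆ ProjSupp P C.Ic x ∪ InjSupp P C.Ic y

/-- mildness in the transit case: `C` is non-deep, `v⃗` is transit, and every decisive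
full subcategory of `P/π(y)v⃗` with at most 4 points is representation-finite -/
def MildTransit : Prop :=
  C.NonDeep ∧ P.IsTransit C.v.toHom ∧
    ∀ D : Set P.Obj, C.DecisiveT D → D.Finite → D.ncard ≤ 4 → RepFin P D C.It

/-- mildness in the cotransit case (dual) -/
def MildCotransit : Prop :=
  C.NonDeep ∧ P.IsCotransit C.v.toHom ∧
    ∀ D : Set P.Obj, C.DecisiveC D → D.Finite → D.ncard ≤ 4 → RepFin P D C.Ic

/-- a mild contour -/
def Mild : Prop := C.MildTransit ∨ C.MildCotransit

/-- equality of contours (with possibly different endpoints), as sets `{v,w}` -/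
def Same {x' y' : P.Obj} (C' : Contour P x' y') : Prop :=
  ∃ (_ : x = x') (_ : y = y'),
    (HEq C.v C'.v ∧ HEq C.w C'.w) ∨ (HEq C.v C'.w ∧ HEq C.w C'.v)

end Contour
/-- the full subcategory on `{x,y}` is a dumb-bell with loops `lam`, `rho`, arrow `mu`
and nilpotency indices `r`, `s` -/
def DumbBellData (P : RayCategory) (x y : P.Obj) (lam : P.Hom x x) (mu : P.Hom x y)
    (rho : P.Hom y y) (r s : ℕ) : Prop :=
  x ≠ y ∧
  P.IsIrreducibleOn {x, y} lam ∧ P.IsIrreducibleOn {x, y} mu ∧ P.IsIrreducibleOn {x, y} rho ∧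
  (∀ a b : P.Obj, a ∈ ({x, y} : Set P.Obj) → b ∈ ({x, y} : Set P.Obj) →
      ∀ f : P.Hom a b, P.IsIrreducibleOn {x, y} f → HEq f lam ∨ HEq f mu ∨ HEq f rho) ∧
  P.comp mu lam = P.comp rho mu ∧
  P.pow lam r = P.zero x x ∧ P.pow rho s = P.zero y y ∧
  P.pow lam (r - 1) ≠ P.zero x x ∧ P.pow rho (s - 1) ≠ P.zero y y ∧
  min r s = 3 ∧ max r s ≤ 5 ∧
  (∀ f : P.Hom x x, ∃ i : ℕ, f = P.pow lam i) ∧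
  (∀ f : P.Hom y y, ∃ i : ℕ, f = P.pow rho i) ∧
  (∀ f : P.Hom x y, f = P.zero x y ∨ ∃ i : ℕ, f = P.comp mu (P.pow lam i)) ∧
  (∀ i : ℕ, i < min r s → P.comp mu (P.pow lam i) ≠ P.zero x y) ∧
  (∀ f : P.Hom y x, f = P.zero y x)

/-- the full subcategory supported by `S` is a dumb-bell -/
def IsDumbBellOn (P : RayCategory) (S : Set P.Obj) : Prop :=
  ∃ (x y : P.Obj) (lam : P.Hom x x) (mu : P.Hom x y) (rho : P.Hom y y) (r s : ℕ),
    DumbBellData P x y lam mu rho r s ∧ S = {x, y}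

/-- the full subcategory on the points `x 0, …, x (n-1)` is a penny-farthing with arrows
`a i` (`a i = α_{i+1} : x_i → x_{i+1}`, indices mod `n`) and loop `rho` at `x 0` -/
def PennyData (P : RayCategory) (n : ℕ) (x : ℕ → P.Obj)
    (a : ∀ i : ℕ, P.Hom (x i) (x (i + 1))) (rho : P.Hom (x 0) (x 0)) : Prop :=
  1 ≤ n ∧
  (∀ i, x (i + n) = x i) ∧ (∀ i, HEq (a (i + n)) (a i)) ∧
  (∀ i j, i < n → j < n → x i = x j → i = j) ∧
  (∀ i, P.IsIrreducibleOn (Set.range x) (a i)) ∧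
  P.IsIrreducibleOn (Set.range x) rho ∧
  (∀ b c : P.Obj, b ∈ Set.range x → c ∈ Set.range x → ∀ f : P.Hom b c,
      P.IsIrreducibleOn (Set.range x) f → HEq f rho ∨ ∃ i, i < n ∧ HEq f (a i)) ∧
  -- relation α₁αₙ = 0
  P.chain x a (n - 1) 2 = P.zero (x (n - 1)) (x (n - 1 + 2)) ∧
  -- relation αₙ⋯α₁ = ρ²
  (∀ h : x (0 + n) = x 0, P.castHom rfl h (P.chain x a 0 n) = P.comp rho rho) ∧
  -- relations 0 = α_{e i}⋯α₁ ρ αₙ⋯α_{i+1} for a non-decreasing e : {1,…,n-1} → {1,…,n}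
  ∃ e : ℕ → ℕ,
    (∀ i, 1 ≤ i → i ≤ n - 1 → 1 ≤ e i ∧ e i ≤ n) ∧
    (∀ i j, 1 ≤ i → i ≤ j → j ≤ n - 1 → e i ≤ e j) ∧
    (∀ i, 1 ≤ i → i ≤ n - 1 → ∀ h : x (i + (n - i)) = x 0,
      P.comp (P.chain x a 0 (e i))
        (P.comp rho (P.castHom rfl h (P.chain x a i (n - i)))) =
      P.zero (x i) (x (0 + e i)))

/-- the full subcategory supported by `S` is a penny-farthing -/
def IsPennyFarthingOn (P : RayCategory) (S : Set P.Obj) : Prop :=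
  ∃ (n : ℕ) (x : ℕ → P.Obj) (a : ∀ i : ℕ, P.Hom (x i) (x (i + 1))) (rho : P.Hom (x 0) (x 0)),
    PennyData P n x a rho ∧ S = Set.range x

/-- the full subcategory on `{x,z,t,y}` is a diamond with arrows
`gam : x → z`, `lam : z → x`, `del : x → t`, `bet : t → y`, `alp : z → y`, `kap : y → z` -/
def DiamondData (P : RayCategory) (x z t y : P.Obj) (gam : P.Hom x z) (lam : P.Hom z x)
    (del : P.Hom x t) (bet : P.Hom t y) (alp : P.Hom z y) (kap : P.Hom y z) : Prop :=
  (x ≠ z ∧ x ≠ t ∧ x ≠ y ∧ z ≠ t ∧ z ≠ y ∧ t ≠ y) ∧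
  P.IsIrreducibleOn {x, z, t, y} gam ∧ P.IsIrreducibleOn {x, z, t, y} lam ∧
  P.IsIrreducibleOn {x, z, t, y} del ∧ P.IsIrreducibleOn {x, z, t, y} bet ∧
  P.IsIrreducibleOn {x, z, t, y} alp ∧ P.IsIrreducibleOn {x, z, t, y} kap ∧
  (∀ a b : P.Obj, a ∈ ({x, z, t, y} : Set P.Obj) → b ∈ ({x, z, t, y} : Set P.Obj) →
      ∀ f : P.Hom a b, P.IsIrreducibleOn {x, z, t, y} f →
        HEq f gam ∨ HEq f lam ∨ HEq f del ∨ HEq f bet ∨ HEq f alp ∨ HEq f kap) ∧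
  P.comp alp gam = P.comp bet del ∧
  P.comp lam kap = P.zero y x ∧
  P.comp kap alp = P.comp gam lam

/-- the full subcategory supported by `S` is a diamond -/
def IsDiamondOn (P : RayCategory) (S : Set P.Obj) : Prop :=
  ∃ (x z t y : P.Obj) (gam : P.Hom x z) (lam : P.Hom z x) (del : P.Hom x t)
    (bet : P.Hom t y) (alp : P.Hom z y) (kap : P.Hom y z),
    DiamondData P x z t y gam lam del bet alp kap ∧ S = {x, z, t, y}

/-- finite-dimensional modules over the linearization `k(P)` itself -/
abbrev FMod (P : RayCategory) (k : Type) [Field k] := RMod P k Set.univ P.noIdeal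

/-- `M` is projective in the category of finite-dimensional `k(P)`-modules -/
def IsProjFD {P : RayCategory} {k : Type} [Field k] (M : FMod P k) : Prop :=
  ∀ (A B : FMod P k), A.FinDim → B.FinDim → ∀ φ : RModHom A B,
    (∀ x, Function.Surjective (φ.app x)) → ∀ ψ : RModHom M B,
      ∃ χ : RModHom M A, ∀ x, (φ.app x).comp (χ.app x) = ψ.app x

/-- `M` is injective in the category of finite-dimensional `k(P)`-modules -/
def IsInjFD {P : RayCategory} {k : Type} [Field k] (M : FMod P k) : Prop :=
  ∀ (A B : FMod P k), A.FinDim → B.FinDim → ∀ φ : RModHom A B,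
    (∀ x, Function.Injective (φ.app x)) → ∀ ψ : RModHom A M,
      ∃ χ : RModHom B M, ∀ x, (χ.app x).comp (φ.app x) = ψ.app x

namespace RayCategory

variable (P : RayCategory)

theorem pipow_add (x : P.Obj) (m n : ℕ) :
    P.pipow x (m + n) = P.comp (P.pipow x m) (P.pipow x n) := by
  induction m with
  | zero => rw [Nat.zero_add, P.pipow_zero, P.id_comp]
  | succ m ih => rw [Nat.succ_add, P.pipow_succ, ih, P.pipow_succ x m, P.assoc]

theorem pipow_eq_zero {x : P.Obj} {n : ℕ} (hn : P.nilp x ≤ n) :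
    P.pipow x n = P.zero x x := by
  obtain ⟨m, rfl⟩ := Nat.exists_eq_add_of_le hn
  rw [pipow_add, P.pipow_nilp, P.zero_comp]

theorem id_ne_zero (x : P.Obj) : P.id x ≠ P.zero x x := by
  intro h
  apply P.pipow_nilp_ne x
  rw [← P.comp_id (P.pipow x _), h, P.comp_zero]

variable {P}

theorem eq_zero_of_eq_comp_pipow {x y : P.Obj} {f : P.Hom x y} {a : P.Hom y y} {d : ℕ}
    (hd : 1 ≤ d) (h : f = P.comp a (P.comp f (P.pipow x d))) : f = P.zero x y := by
  have key : ∀ n : ℕ, ∃ b : P.Hom y y, f = P.comp b (P.comp f (P.pipow x (d * n))) := by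
    intro n
    induction n with
    | zero => exact ⟨P.id y, by rw [Nat.mul_zero, P.pipow_zero, P.comp_id, P.id_comp]⟩
    | succ n ih =>
      obtain ⟨b, hb⟩ := ih
      refine ⟨P.comp a b, ?_⟩
      calc f = P.comp a (P.comp f (P.pipow x d)) := h
        _ = P.comp a (P.comp (P.comp b (P.comp f (P.pipow x (d * n)))) (P.pipow x d)) := by
          rw [← hb]
        _ = _ := by rw [Nat.mul_succ, pipow_add]; simp only [P.assoc]
  obtain ⟨b, hb⟩ := key (P.nilp x)
  rw [hb, P.pipow_eq_zero (Nat.le_mul_of_pos_left _ hd), P.comp_zero, P.comp_zero]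

theorem pipow_eq_id {x : P.Obj} {n : ℕ} (h : P.pipow x n = P.id x) : n = 0 := by
  by_contra hn
  apply P.id_ne_zero x
  refine eq_zero_of_eq_comp_pipow (a := P.id x) (Nat.one_le_iff_ne_zero.2 hn) ?_
  rw [h, P.id_comp, P.id_comp]

theorem isId_id (x : P.Obj) : P.IsId (P.id x) := ⟨rfl, HEq.rfl⟩

theorem isId_iff {x : P.Obj} {f : P.Hom x x} : P.IsId f ↔ f = P.id x :=
  ⟨fun ⟨_, h⟩ => eq_of_heq h, fun h => h ▸ isId_id x⟩

theorem isId_of_comp_eq_id {v w : P.Obj} {g : P.Hom v w} {g' : P.Hom w v}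
    (h : P.comp g g' = P.id w) : P.IsId g ∧ P.IsId g' := by
  obtain ⟨i, hi⟩ := P.endo_cyclic v (P.comp g' g)
  have hidem : P.comp (P.comp g' g) (P.comp g' g) = P.comp g' g := by
    rw [P.assoc, ← P.assoc g g' g, h, P.id_comp]
  rcases Nat.eq_zero_or_pos i with rfl | hpos
  · rw [P.pipow_zero] at hi
    obtain rfl := P.no_iso g g' hi h
    obtain ⟨a, rfl⟩ := P.endo_cyclic v g
    obtain ⟨b, rfl⟩ := P.endo_cyclic v g'
    rw [← P.pipow_add] at h
    have := pipow_eq_id h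
    obtain ⟨rfl, rfl⟩ : a = 0 ∧ b = 0 := by omega
    simp only [isId_iff, P.pipow_zero, and_self]
  · have h0 : P.pipow v i = P.zero v v := by
      refine eq_zero_of_eq_comp_pipow (a := P.id v) hpos ?_
      rw [P.id_comp, ← hi, hidem]
    exfalso
    apply P.id_ne_zero w
    calc P.id w = P.comp (P.comp g g') (P.comp g g') := by rw [h, P.id_comp]
      _ = P.comp g (P.comp (P.comp g' g) g') := by simp only [P.assoc]
      _ = P.zero w w := by rw [hi, h0, P.zero_comp, P.comp_zero]

theorem not_isId_zero {x y : P.Obj} : ¬ P.IsId (P.zero x y) := by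
  rintro ⟨rfl, h⟩
  exact P.id_ne_zero x (eq_of_heq h).symm

theorem isId_of_isId_comp {x y z : P.Obj} {g : P.Hom y z} {f : P.Hom x y}
    (h : P.IsId (P.comp g f)) : P.IsId g := by
  obtain ⟨rfl, h⟩ := h
  exact (isId_of_comp_eq_id (eq_of_heq h)).1

theorem comp_left_cancel {x y z : P.Obj} {f f' : P.Hom x y} {g : P.Hom y z}
    (h : P.comp g f = P.comp g f') (hne : P.comp g f ≠ P.zero x z) : f = f' :=
  P.cancel (P.id x) f f' g (by rw [P.comp_id, P.comp_id, h]) (by rwa [P.comp_id])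

theorem comp_right_cancel {x y z : P.Obj} {f : P.Hom x y} {g g' : P.Hom y z}
    (h : P.comp g f = P.comp g' f) (hne : P.comp g f ≠ P.zero x z) : g = g' :=
  P.cancel f g g' (P.id z) (by rw [P.id_comp, P.id_comp, h]) (by rwa [P.id_comp])

theorem comp_eq_self_iff_right {x y : P.Obj} {f : P.Hom x y} (hf : f ≠ P.zero x y)
    {t : P.Hom x x} : P.comp f t = f ↔ t = P.id x := by
  refine ⟨fun h => comp_left_cancel (g := f) ?_ ?_, ?_⟩
  · rw [h, P.comp_id]
  · rwa [h]
  · rintro rfl; exact P.comp_id f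

theorem comp_eq_self_iff_left {x y : P.Obj} {f : P.Hom x y} (hf : f ≠ P.zero x y)
    {t : P.Hom y y} : P.comp t f = f ↔ t = P.id y := by
  refine ⟨fun h => comp_right_cancel (f := f) ?_ ?_, ?_⟩
  · rw [h, P.id_comp]
  · rwa [h]
  · rintro rfl; exact P.id_comp f

instance finite_hom (x y : P.Obj) : Finite (P.Hom x y) := by
  have hend : ∀ z : P.Obj, (Set.range (fun i : Fin (P.nilp z + 1) => P.pipow z i)) = Set.univ := by
    intro z
    refine Set.eq_univ_of_forall fun f => ?_
    obtain ⟨i, rfl⟩ := P.endo_cyclic z f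
    rcases lt_or_ge i (P.nilp z) with h | h
    · exact ⟨⟨i, by omega⟩, rfl⟩
    · exact ⟨⟨P.nilp z, by omega⟩, by rw [P.pipow_eq_zero h]; exact P.pipow_nilp z⟩
  have hfin : ∀ z : P.Obj, Finite (P.Hom z z) := fun z =>
    Set.finite_univ_iff.1 (hend z ▸ Set.finite_range _)
  obtain ⟨g, h | h⟩ := P.hom_cyclic x y
  · have := hfin y
    refine Finite.of_surjective (fun t : P.Hom y y => P.comp t g) fun f => ?_
    obtain ⟨i, hi⟩ := h f
    exact ⟨_, hi.symm⟩
  · have := hfin x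
    refine Finite.of_surjective (fun t : P.Hom x x => P.comp g t) fun f => ?_
    obtain ⟨i, hi⟩ := h f
    exact ⟨_, hi.symm⟩

/-- A nonzero family of morphisms into `x` contains a member that leaves the family when
precomposed with any non-identity morphism. -/
theorem exists_maximal_precomp {x : P.Obj} (Q : ∀ w, P.Hom w x → Prop)
    (hQ : ∀ w u, Q w u → u ≠ P.zero w x) {w₀ : P.Obj} {u₀ : P.Hom w₀ x} (h₀ : Q w₀ u₀) :
    ∃ w u, Q w u ∧ ∀ v (g : P.Hom v w), ¬ P.IsId g → ¬ Q v (P.comp u g) := by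
  let _ : Preorder (Σ w, P.Hom w x) :=
    { le := fun a b => ∃ g, b.2 = P.comp a.2 g
      le_refl := fun a => ⟨P.id _, (P.comp_id _).symm⟩
      le_trans := by
        rintro a b c ⟨g, hg⟩ ⟨g', hg'⟩
        exact ⟨P.comp g g', by rw [hg', hg, P.assoc]⟩ }
  let A : Set (Σ w, P.Hom w x) := {a | Q a.1 a.2}
  have hA : A.Finite := by
    refine Set.Finite.subset ((P.finite_source x).biUnion fun w _ =>
      Set.finite_range (Sigma.mk (β := fun w => P.Hom w x) w)) ?_
    rintro ⟨w, u⟩ h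
    exact Set.mem_biUnion (x := w) ⟨u, hQ w u h⟩ ⟨u, rfl⟩
  obtain ⟨⟨w, u⟩, hmem, hmax⟩ := hA.exists_maximal ⟨⟨w₀, u₀⟩, h₀⟩
  refine ⟨w, u, hmem, fun v g hg hq => hg ?_⟩
  obtain ⟨g', hg'⟩ := hmax (y := ⟨v, P.comp u g⟩) hq ⟨g, rfl⟩
  have h2 : P.comp u (P.comp g g') = u := by rw [← P.assoc]; exact hg'.symm
  exact (isId_of_comp_eq_id ((comp_eq_self_iff_right (hQ w u hmem)).1 h2)).1

/-- Some nonzero morphism starting in `x` is annihilated by every non-identity morphism. -/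
theorem exists_socle (x : P.Obj) :
    ∃ (y : P.Obj) (f : P.Hom x y), f ≠ P.zero x y ∧
      ∀ z (g : P.Hom y z), ¬ P.IsId g → P.comp g f = P.zero x z := by
  let _ : Preorder (Σ w, P.Hom x w) :=
    { le := fun a b => ∃ g, b.2 = P.comp g a.2
      le_refl := fun a => ⟨P.id _, (P.id_comp _).symm⟩
      le_trans := by
        rintro a b c ⟨g, hg⟩ ⟨g', hg'⟩
        exact ⟨P.comp g' g, by rw [hg', hg, P.assoc]⟩ }
  let A : Set (Σ w, P.Hom x w) := {a | a.2 ≠ P.zero x a.1}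
  have hA : A.Finite := by
    refine Set.Finite.subset ((P.finite_target x).biUnion fun w _ =>
      Set.finite_range (Sigma.mk (β := fun w => P.Hom x w) w)) ?_
    rintro ⟨w, u⟩ h
    exact Set.mem_biUnion (x := w) ⟨u, h⟩ ⟨u, rfl⟩
  obtain ⟨⟨y, f⟩, hmem, hmax⟩ := hA.exists_maximal ⟨⟨x, P.id x⟩, P.id_ne_zero x⟩
  refine ⟨y, f, hmem, fun z g hg => by_contra fun hq => hg ?_⟩
  obtain ⟨g', hg'⟩ := hmax (y := ⟨z, P.comp g f⟩) hq ⟨g, rfl⟩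
  have h2 : P.comp (P.comp g' g) f = f := by rw [P.assoc]; exact hg'.symm
  exact (isId_of_comp_eq_id ((comp_eq_self_iff_left hmem).1 h2)).2

/-- Composition with `f` as value is a perfect pairing between the nonzero morphisms starting
in `x` and the nonzero morphisms ending in `y`. -/
def IsPerfectPairing {x y : P.Obj} (f : P.Hom x y) : Prop :=
  f ≠ P.zero x y ∧
    (∀ z (g : P.Hom x z), g ≠ P.zero x z → ∃ h, P.comp h g = f) ∧
    ∀ z (h : P.Hom z y), h ≠ P.zero z y → ∃ g, P.comp h g = f

theorem IsPerfectPairing.exists_isolating {x y : P.Obj} {f : P.Hom x y}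
    (hf : IsPerfectPairing f) {z : P.Obj} (T : Finset (P.Hom x z)) (hT : T.Nonempty)
    (hT0 : ∀ g ∈ T, g ≠ P.zero x z) :
    ∃ g ∈ T, ∃ h : P.Hom z y, P.comp h g = f ∧
      ∀ g' ∈ T, g' ≠ g → P.comp h g' = P.zero x y := by
  obtain ⟨hf0, hf1, -⟩ := hf
  obtain ⟨g₀, hc | hc⟩ := P.hom_cyclic x z
  · choose idx hidx using hc
    obtain ⟨g, hg, hmin⟩ := T.exists_min_image idx hT
    obtain ⟨h, hh⟩ := hf1 z g (hT0 g hg)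
    refine ⟨g, hg, h, hh, fun g' hg' hne => by_contra fun hnz => hf0 ?_⟩
    obtain ⟨d, hd⟩ := Nat.exists_eq_add_of_le (hmin g' hg')
    have hd0 : 1 ≤ d := by
      rcases Nat.eq_zero_or_pos d with rfl | h1
      · exact absurd (by rw [hidx g', hidx g, hd, Nat.add_zero]) hne
      · exact h1
    have hg'' : g' = P.comp (P.pipow z d) g := by
      rw [hidx g', hd, Nat.add_comm, P.pipow_add, P.assoc, ← hidx g]
    obtain ⟨h', hh'⟩ := hf1 y _ hnz
    have : P.comp (P.comp h' (P.comp h (P.pipow z d))) g = P.comp h g := by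
      rw [hh, ← hh', hg'']; simp only [P.assoc]
    have h3 := comp_right_cancel this (by rw [this, hh]; exact hf0)
    rw [← hh, eq_zero_of_eq_comp_pipow hd0 h3.symm, P.zero_comp]
  · choose idx hidx using hc
    obtain ⟨g, hg, hmin⟩ := T.exists_min_image idx hT
    obtain ⟨h, hh⟩ := hf1 z g (hT0 g hg)
    refine ⟨g, hg, h, hh, fun g' hg' hne => by_contra fun hnz => hf0 ?_⟩
    obtain ⟨d, hd⟩ := Nat.exists_eq_add_of_le (hmin g' hg')
    have hd0 : 1 ≤ d := by
      rcases Nat.eq_zero_or_pos d with rfl | h1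
      · exact absurd (by rw [hidx g', hidx g, hd, Nat.add_zero]) hne
      · exact h1
    have hg'' : g' = P.comp g (P.pipow x d) := by
      rw [hidx g', hd, P.pipow_add, ← P.assoc, ← hidx g]
    obtain ⟨h', hh'⟩ := hf1 y _ hnz
    refine eq_zero_of_eq_comp_pipow (a := h') hd0 ?_
    rw [← hh, P.assoc, ← hg'', hh', hh]

theorem IsPerfectPairing.card_le {x y : P.Obj} {f : P.Hom x y} (hf : IsPerfectPairing f)
    (z : P.Obj) :
    Nat.card {h : P.Hom z y // h ≠ P.zero z y} ≤ Nat.card {g : P.Hom x z // g ≠ P.zero x z} := by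
  obtain ⟨hf0, -, hf2⟩ := hf
  choose s hs using fun h : {h : P.Hom z y // h ≠ P.zero z y} => hf2 z h.1 h.2
  refine Nat.card_le_card_of_injective (fun h => ⟨s h, fun h0 => hf0 ?_⟩) ?_
  · rw [← hs h, h0, P.comp_zero]
  · intro h h' heq
    have heq : s h = s h' := congrArg Subtype.val heq
    refine Subtype.ext (comp_right_cancel (f := s h) ?_ ?_)
    · rw [hs, heq, hs]
    · rwa [hs]

end RayCategory

namespace RModHom

variable {P : RayCategory} {k : Type} [Field k] {D : Set P.Obj}
  {I : ∀ a b : P.Obj, P.Hom a b → Prop} {L M N : RMod P k D I}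

theorem app_act (φ : RModHom M N) {x y : P.Obj} (f : P.Hom x y) (m : M.M x) :
    φ.app y (M.act f m) = N.act f (φ.app x m) :=
  (LinearMap.congr_fun (φ.natural f) m).symm

/-- composition of morphisms of modules -/
def comp (ψ : RModHom M N) (φ : RModHom L M) : RModHom L N where
  app x := (ψ.app x).comp (φ.app x)
  natural f := by
    ext m
    simp only [LinearMap.comp_apply, app_act]

/-- the inverse of a bijective morphism of modules -/
noncomputable def inv (φ : RModHom M N) (h : ∀ x, Function.Bijective (φ.app x)) :
    RModHom N M where
  app x := (LinearEquiv.ofBijective (φ.app x) (h x)).symm.toLinearMap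
  natural {x y} f := by
    ext m
    obtain ⟨m, rfl⟩ := (h x).2 m
    apply (h y).1
    have e : ∀ z (a : N.M z), φ.app z ((LinearEquiv.ofBijective (φ.app z) (h z)).symm a) = a :=
      fun z a => LinearEquiv.apply_symm_apply (LinearEquiv.ofBijective (φ.app z) (h z)) a
    simp only [LinearMap.comp_apply, LinearEquiv.coe_coe, app_act, e]

theorem inv_app_app (φ : RModHom M N) (h : ∀ x, Function.Bijective (φ.app x)) (x : P.Obj)
    (m : M.M x) : (φ.inv h).app x (φ.app x m) = m :=
  LinearEquiv.symm_apply_apply (LinearEquiv.ofBijective (φ.app x) (h x)) m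

end RModHom

namespace FMod

open RayCategory

variable {P : RayCategory} {k : Type} [Field k]

theorem act_id_apply (M : FMod P k) {x : P.Obj} (m : M.M x) : M.act (P.id x) m = m := by
  rw [M.act_id x trivial]; rfl

theorem act_comp_apply (M : FMod P k) {x y z : P.Obj} (g : P.Hom y z) (f : P.Hom x y)
    (m : M.M x) : M.act (P.comp g f) m = M.act g (M.act f m) := by
  rw [M.act_comp trivial trivial trivial]; rfl

theorem act_zero_apply (M : FMod P k) {x y : P.Obj} (m : M.M x) : M.act (P.zero x y) m = 0 := by
  rw [M.act_zero trivial trivial]; rfl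

variable (P k) in
/-- the indecomposable projective module at `x` -/
noncomputable def proj (x : P.Obj) : FMod P k where
  M z := (P.Hom x z →₀ k) ⧸ Submodule.span k {Finsupp.single (P.zero x z) (1 : k)}
  act g := Submodule.mapQ _ _ (Finsupp.lmapDomain k k (P.comp g)) (by
    rw [Submodule.span_le, Set.singleton_subset_iff, SetLike.mem_coe, Submodule.mem_comap,
      Finsupp.lmapDomain_apply, Finsupp.mapDomain_single, P.comp_zero]
    exact Submodule.mem_span_singleton_self _)
  act_id x _ := by
    ext t
    simp [P.id_comp]
  act_comp _ _ _ g f := by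
    ext t
    simp [P.assoc]
  act_zero _ _ := by
    ext t
    simp only [LinearMap.comp_apply, Submodule.mkQ_apply, Submodule.mapQ_apply,
      Finsupp.lsingle_apply, Finsupp.lmapDomain_apply, Finsupp.mapDomain_single, P.zero_comp]
    exact (Submodule.Quotient.mk_eq_zero _).2 (Submodule.mem_span_singleton_self _)
  supp x hx := absurd trivial hx
  killed _ h := h.elim

variable (k) in
/-- the basis vector of the projective module `proj P k x` given by a morphism -/
noncomputable def basisVec {x z : P.Obj} (g : P.Hom x z) : (proj P k x).M z :=
  Submodule.Quotient.mk (Finsupp.single g 1)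

theorem proj_hom_ext {x z : P.Obj} {V : Type} [AddCommGroup V] [Module k V]
    {φ ψ : (proj P k x).M z →ₗ[k] V} (h : ∀ g : P.Hom x z, φ (basisVec k g) = ψ (basisVec k g)) :
    φ = ψ := by
  refine Submodule.linearMap_qext _ (Finsupp.lhom_ext' fun g => LinearMap.ext_ring ?_)
  exact h g

theorem act_basisVec {x z w : P.Obj} (h : P.Hom z w) (g : P.Hom x z) :
    (proj P k x).act h (basisVec k g) = basisVec k (P.comp h g) := by
  change (Submodule.Quotient.mk (Finsupp.mapDomain (P.comp h) (Finsupp.single g 1)) :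
    (P.Hom x w →₀ k) ⧸ Submodule.span k {Finsupp.single (P.zero x w) (1 : k)}) = _
  rw [Finsupp.mapDomain_single]
  rfl

variable (k) in
/-- the coefficient functional of a nonzero morphism -/
noncomputable def coeff {x z : P.Obj} (g : P.Hom x z) (hg : g ≠ P.zero x z) :
    (proj P k x).M z →ₗ[k] k :=
  Submodule.liftQ _ (Finsupp.lapply g) (by
    rw [Submodule.span_le, Set.singleton_subset_iff, SetLike.mem_coe, LinearMap.mem_ker,
      Finsupp.lapply_apply, Finsupp.single_eq_of_ne hg])

open Classical in
theorem coeff_basisVec {x z : P.Obj} (g : P.Hom x z) (hg : g ≠ P.zero x z) (g' : P.Hom x z) :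
    coeff k g hg (basisVec k g') = if g' = g then 1 else 0 := by
  change Finsupp.single g' (1 : k) g = _
  rw [Finsupp.single_apply]

theorem coeff_act_self {x z : P.Obj} (g : P.Hom x z) (hg : g ≠ P.zero x z)
    (v : (proj P k x).M x) :
    coeff k g hg ((proj P k x).act g v) = coeff k (P.id x) (P.id_ne_zero x) v := by
  classical
  refine LinearMap.congr_fun (f := (coeff k g hg).comp ((proj P k x).act g))
    (proj_hom_ext fun t => ?_) v
  rw [LinearMap.comp_apply, act_basisVec, coeff_basisVec, coeff_basisVec]
  simp only [comp_eq_self_iff_right hg]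

theorem coeff_act_eq_zero {x z y : P.Obj} {f : P.Hom x y} (hf : f ≠ P.zero x y) {h : P.Hom z y}
    (hh : ∀ g, P.comp h g ≠ f) (v : (proj P k x).M z) :
    coeff k f hf ((proj P k x).act h v) = 0 := by
  classical
  refine LinearMap.congr_fun (f := (coeff k f hf).comp ((proj P k x).act h)) (g := 0)
    (proj_hom_ext fun t => ?_) v
  rw [LinearMap.comp_apply, act_basisVec, coeff_basisVec, if_neg (hh t)]
  rfl

/-- the components of the morphism out of a projective module determined by an element -/
noncomputable def ofElemApp (N : FMod P k) {x : P.Obj} (n : N.M x) (z : P.Obj) :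
    (proj P k x).M z →ₗ[k] N.M z :=
  Submodule.liftQ _ (Finsupp.linearCombination k fun g => N.act g n) (by
    rw [Submodule.span_le, Set.singleton_subset_iff, SetLike.mem_coe, LinearMap.mem_ker,
      Finsupp.linearCombination_single, act_zero_apply, smul_zero])

theorem ofElemApp_basisVec (N : FMod P k) {x z : P.Obj} (n : N.M x) (g : P.Hom x z) :
    ofElemApp N n z (basisVec k g) = N.act g n := by
  change Finsupp.linearCombination k (fun g => N.act g n) (Finsupp.single g 1) = _
  rw [Finsupp.linearCombination_single, one_smul]

/-- the morphism out of a projective module determined by an element -/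
noncomputable def ofElem (N : FMod P k) {x : P.Obj} (n : N.M x) : RModHom (proj P k x) N where
  app := ofElemApp N n
  natural f := by
    refine proj_hom_ext fun g => ?_
    rw [LinearMap.comp_apply, LinearMap.comp_apply, act_basisVec, ofElemApp_basisVec,
      ofElemApp_basisVec, act_comp_apply]

theorem ofElem_basisVec (N : FMod P k) {x z : P.Obj} (n : N.M x) (g : P.Hom x z) :
    (ofElem N n).app z (basisVec k g) = N.act g n :=
  ofElemApp_basisVec N n g

theorem finDim_proj (x : P.Obj) : (proj P k x).FinDim := by
  refine ⟨fun z => inferInstanceAs (FiniteDimensional k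
    ((P.Hom x z →₀ k) ⧸ Submodule.span k {Finsupp.single (P.zero x z) (1 : k)})),
    (P.finite_target x).subset ?_⟩
  · rintro z ⟨m, hm⟩
    by_contra hz
    refine hm ?_
    have : LinearMap.id (M := (proj P k x).M z) = (0 : _ →ₗ[k] _) := proj_hom_ext fun g => by
      have hg : g = P.zero x z := by_contra fun h => hz ⟨g, h⟩
      subst hg
      exact (Submodule.Quotient.mk_eq_zero _).2 (Submodule.mem_span_singleton_self _)
    exact LinearMap.congr_fun this m

/-- a right-closed family of morphisms with target `y` -/
structure RightClosed (y : P.Obj) where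
  mem : ∀ z, P.Hom z y → Prop
  zero_mem : ∀ z, mem z (P.zero z y)
  comp_mem : ∀ {w z} (u : P.Hom z y) (g : P.Hom w z), mem z u → mem w (P.comp u g)

variable (k) in
/-- the submodule of the injective module at `y` of functions vanishing on `V` -/
def dualRep {y : P.Obj} (V : RightClosed y) : FMod P k where
  M z := ({ carrier := {φ | ∀ u, V.mem z u → φ u = 0}
            add_mem' := fun ha hb u hu => by rw [Pi.add_apply, ha u hu, hb u hu, add_zero]
            zero_mem' := fun _ _ => rfl
            smul_mem' := fun c a ha u hu => by rw [Pi.smul_apply, ha u hu, smul_zero] } :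
          Submodule k (P.Hom z y → k))
  act g := LinearMap.restrict (LinearMap.funLeft k k fun u => P.comp u g)
    fun _ hφ u hu => hφ _ (V.comp_mem u g hu)
  act_id x _ := by
    ext φ u
    change φ.1 (P.comp u (P.id x)) = φ.1 u
    rw [P.comp_id]
  act_comp _ _ _ g f := by
    ext φ u
    change φ.1 (P.comp u (P.comp g f)) = φ.1 (P.comp (P.comp u g) f)
    rw [P.assoc]
  act_zero _ _ := by
    ext φ u
    change φ.1 (P.comp u (P.zero _ _)) = 0
    rw [P.comp_zero]
    exact φ.2 _ (V.zero_mem _)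
  supp x hx := absurd trivial hx
  killed _ h := h.elim

section dualRep

variable {y : P.Obj} {V : RightClosed y}

theorem dualRep_act {z w : P.Obj} (g : P.Hom z w) (φ : (dualRep k V).M z) (u : P.Hom w y) :
    ((dualRep k V).act g φ).1 u = φ.1 (P.comp u g) := rfl

theorem finDim_dualRep : (dualRep k V).FinDim := by
  refine ⟨fun z => ?_, (P.finite_source y).subset ?_⟩
  · change FiniteDimensional k (Submodule.mk _ _ : Submodule k (P.Hom z y → k))
    infer_instance
  · rintro z ⟨φ, hφ⟩
    by_contra hz
    refine hφ (Subtype.ext (funext fun u => ?_))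
    have hu : u = P.zero z y := by_contra fun h => hz ⟨u, h⟩
    exact φ.2 u (hu ▸ V.zero_mem z)

variable (k) in
open Classical in
/-- the delta function at a morphism outside of `V` -/
noncomputable def delta {z : P.Obj} (u : P.Hom z y) (hu : ¬ V.mem z u) : (dualRep k V).M z :=
  ⟨fun t => if t = u then 1 else 0, fun t ht => if_neg (by rintro rfl; exact hu ht)⟩

open Classical in
theorem delta_apply {z : P.Obj} (u : P.Hom z y) (hu : ¬ V.mem z u) (t : P.Hom z y) :
    (delta k u hu).1 t = if t = u then 1 else 0 := rfl

theorem act_delta_self {z : P.Obj} (u : P.Hom z y) (hu : ¬ V.mem z u)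
    (hid : ¬ V.mem y (P.id y)) :
    (dualRep k V).act u (delta k u hu) = delta k (P.id y) hid := by
  classical
  have h0 : u ≠ P.zero z y := fun h => hu (h ▸ V.zero_mem z)
  refine Subtype.ext (funext fun t => ?_)
  rw [dualRep_act, delta_apply, delta_apply]
  simp only [comp_eq_self_iff_left h0]

/-- the morphism into a dual module determined by a linear form -/
def toDual (N : FMod P k) (ξ : N.M y →ₗ[k] k)
    (hξ : ∀ z (u : P.Hom z y), V.mem z u → ∀ n, ξ (N.act u n) = 0) :
    RModHom N (dualRep k V) where
  app z :=
    { toFun := fun n => ⟨fun u => ξ (N.act u n), fun u hu => hξ z u hu n⟩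
      map_add' := fun a b => Subtype.ext (funext fun u => by
        change ξ (N.act u (a + b)) = ξ (N.act u a) + ξ (N.act u b)
        rw [map_add, map_add])
      map_smul' := fun c a => Subtype.ext (funext fun u => by
        change ξ (N.act u (c • a)) = c • ξ (N.act u a)
        rw [map_smul, map_smul]) }
  natural f := by
    refine LinearMap.ext fun n => Subtype.ext (funext fun u => ?_)
    change ξ (N.act (P.comp u f) n) = ξ (N.act u (N.act f n))
    rw [act_comp_apply]

theorem toDual_apply (N : FMod P k) (ξ : N.M y →ₗ[k] k)
    (hξ : ∀ z (u : P.Hom z y), V.mem z u → ∀ n, ξ (N.act u n) = 0) {z : P.Obj} (n : N.M z)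
    (u : P.Hom z y) : ((toDual N ξ hξ).app z n).1 u = ξ (N.act u n) := rfl

end dualRep

/-- the family of zero morphisms, whose dual module is the injective module at `y` -/
def zeros (y : P.Obj) : RightClosed y where
  mem z u := u = P.zero z y
  zero_mem _ := rfl
  comp_mem u g h := by rw [h, P.zero_comp]

/-- the family of non-identity morphisms, whose dual module is the simple module at `y` -/
def nonIds (y : P.Obj) : RightClosed y where
  mem _ u := ¬ P.IsId u
  zero_mem _ := not_isId_zero
  comp_mem _ _ h h' := h (isId_of_isId_comp h')

variable (k) in
/-- the inclusion of the simple module into its injective hull -/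
def socleIncl (y : P.Obj) : RModHom (dualRep k (nonIds y)) (dualRep k (zeros y)) where
  app z := Submodule.inclusion fun _ hφ u hu => hφ u (by
    rw [show u = P.zero z y from hu]; exact not_isId_zero)
  natural _ := rfl

theorem socleIncl_injective (y z : P.Obj) : Function.Injective ((socleIncl k y).app z) :=
  fun a b h => Subtype.ext (show a.1 = b.1 from
    congrArg (fun φ : (dualRep k (zeros y)).M z => φ.1) h)

theorem simple_eq_zero {y z : P.Obj} (h : z ≠ y) (φ : (dualRep k (nonIds y)).M z) : φ = 0 :=
  Subtype.ext (funext fun u => φ.2 u fun hu => h hu.1)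

/-- an element annihilated by all non-identity morphisms defines a morphism from the simple
module -/
noncomputable def ofSocle (N : FMod P k) {y : P.Obj} (n : N.M y)
    (hn : ∀ z (g : P.Hom y z), ¬ P.IsId g → N.act g n = 0) :
    RModHom (dualRep k (nonIds y)) N := by
  classical
  exact
  { app := fun z => if h : z = y then by
        subst h
        exact ((LinearMap.proj (P.id z)).comp (Submodule.subtype _)).smulRight n
      else 0
    natural := by
      intro z w f
      refine LinearMap.ext fun φ => ?_
      by_cases hz : z = y
      · subst hz
        by_cases hf : P.IsId f
        · obtain ⟨rfl, hf⟩ := hf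
          obtain rfl := eq_of_heq hf
          rw [LinearMap.comp_apply, LinearMap.comp_apply, act_id_apply, act_id_apply]
        · have h2 : (dualRep k (nonIds z)).act f φ = 0 := by
            refine Subtype.ext (funext fun u => φ.2 _ fun hu => hf ?_)
            obtain ⟨_, hu⟩ := hu
            exact (isId_of_comp_eq_id (eq_of_heq hu)).2
          rw [LinearMap.comp_apply, LinearMap.comp_apply, h2, map_zero, dif_pos rfl]
          change N.act f (φ.1 (P.id z) • n) = 0
          rw [map_smul, hn w f hf, smul_zero]
      · rw [simple_eq_zero hz φ, map_zero, map_zero] }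

theorem ofSocle_delta (N : FMod P k) {y : P.Obj} (n : N.M y)
    (hn : ∀ z (g : P.Hom y z), ¬ P.IsId g → N.act g n = 0)
    (hid : ¬ (nonIds y).mem y (P.id y)) :
    (ofSocle N n hn).app y (delta k (P.id y) hid) = n := by
  classical
  simp only [ofSocle, dif_pos]
  change (if P.id y = P.id y then (1 : k) else 0) • n = n
  rw [if_pos rfl, one_smul]

theorem exists_form {V : Type} [AddCommGroup V] [Module k V] {v : V} (hv : v ≠ 0) :
    ∃ ξ : V →ₗ[k] k, ξ v = 1 := by
  obtain ⟨ξ, hξ⟩ : ∃ ξ : Module.Dual k V, ξ v ≠ 0 := by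
    by_contra! h
    exact hv ((Module.forall_dual_apply_eq_zero_iff k v).1 h)
  exact ⟨(ξ v)⁻¹ • ξ, by rw [LinearMap.smul_apply, smul_eq_mul, inv_mul_cancel₀ hξ]⟩

theorem exists_isPerfectPairing (M : FMod P k) (hproj : IsProjFD M)
    (hinj : IsInjFD M) (hne : M.Nonzero) :
    ∃ (x y : P.Obj) (f : P.Hom x y), IsPerfectPairing f := by
  classical
  obtain ⟨x₀, m₀, hm₀⟩ := hne
  obtain ⟨x, u, hu, hmax⟩ := exists_maximal_precomp (x := x₀) (fun _ u => M.act u ≠ 0)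
    (fun w u hu h => hu (by rw [h]; exact M.act_zero trivial trivial)) (u₀ := P.id x₀)
    (fun h => hm₀ (by rw [← M.act_id_apply m₀, h]; rfl))
  obtain ⟨m, hm⟩ : ∃ m, M.act u m ≠ 0 := by
    by_contra! h
    exact hu (LinearMap.ext h)
  obtain ⟨ξ, hξ⟩ := exists_form (k := k) hm
  have hnid : ∀ z : P.Obj, ¬ (nonIds z).mem z (P.id z) := fun z h => h (isId_id z)
  let ψ : RModHom M (dualRep k (nonIds x)) := toDual M (ξ.comp (M.act u)) (by
    intro z g hg n
    rw [LinearMap.comp_apply, ← act_comp_apply, not_not.1 (hmax z g hg), LinearMap.zero_apply,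
      map_zero])
  let top : RModHom (proj P k x) (dualRep k (nonIds x)) :=
    ofElem _ (delta k (P.id x) (hnid x))
  have htop : ∀ z, Function.Surjective (top.app z) := by
    intro z φ
    by_cases hz : z = x
    · subst hz
      refine ⟨φ.1 (P.id z) • basisVec k (P.id z), ?_⟩
      rw [map_smul, ofElem_basisVec, act_id_apply]
      refine Subtype.ext (funext fun t => ?_)
      change φ.1 (P.id z) * (if t = P.id z then 1 else 0) = φ.1 t
      split_ifs with h
      · rw [h, mul_one]
      · rw [mul_zero]
        exact (φ.2 t fun ht => h (isId_iff.1 ht)).symm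
    · exact ⟨0, by rw [map_zero, simple_eq_zero hz φ]⟩
  obtain ⟨β, hβ⟩ := hproj _ _ (finDim_proj x) finDim_dualRep top htop ψ
  have hcoeff : coeff k (P.id x) (P.id_ne_zero x) (β.app x m) = 1 := by
    have h1 : (top.app x (β.app x m)).1 (P.id x) = 1 := by
      rw [← LinearMap.comp_apply, hβ x]
      change ξ (M.act u (M.act (P.id x) m)) = 1
      rw [act_id_apply, hξ]
    rw [← h1]
    refine LinearMap.congr_fun (g := ((LinearMap.proj (P.id x)).comp
      (Submodule.subtype _)).comp (top.app x)) (proj_hom_ext fun t => ?_) (β.app x m)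
    rw [coeff_basisVec]
    change _ = ((top.app x) (basisVec k t)).1 (P.id x)
    rw [ofElem_basisVec]
    change _ = if P.comp (P.id x) t = P.id x then (1 : k) else 0
    rw [P.id_comp]
  obtain ⟨y, f, hf0, hsoc⟩ := exists_socle x
  obtain ⟨χ, hχ⟩ := hinj _ _ finDim_dualRep finDim_dualRep (socleIncl k y)
    (socleIncl_injective y) (ofSocle M (M.act f m) (fun z g hg => by
      rw [← act_comp_apply, hsoc z g hg, act_zero_apply]))
  have hid0 : ¬ (zeros y).mem y (P.id y) := P.id_ne_zero y
  let X := β.comp χ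
  have hX : X.app y (delta k (P.id y) hid0) = (proj P k x).act f (β.app x m) := by
    have h1 := LinearMap.congr_fun (hχ y) (delta k (P.id y) (hnid y))
    rw [ofSocle_delta] at h1
    have h2 : χ.app y (delta k (P.id y) hid0) = M.act f m := h1
    change β.app y (χ.app y _) = _
    rw [h2, RModHom.app_act]
  have hXf : coeff k f hf0 (X.app y (delta k (P.id y) hid0)) = 1 := by
    rw [hX, coeff_act_self, hcoeff]
  refine ⟨x, y, f, hf0, fun z g hg => ?_, fun z h hh => ?_⟩
  · by_contra! hno
    have h1 : coeff k (P.id x) (P.id_ne_zero x) (X.app x (delta k f hf0)) = 1 := by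
      rw [← coeff_act_self f hf0, ← RModHom.app_act, act_delta_self f hf0 hid0, hXf]
    have h2 : (dualRep k (zeros y)).act g (delta k f hf0) = 0 :=
      Subtype.ext (funext fun t => if_neg (hno t))
    rw [← coeff_act_self g hg, ← RModHom.app_act, h2, map_zero, map_zero] at h1
    exact zero_ne_one h1
  · by_contra! hno
    rw [← act_delta_self h hh hid0, RModHom.app_act, coeff_act_eq_zero hf0 hno] at hXf
    exact zero_ne_one hXf

theorem finrank_dualRep_le {x y : P.Obj} {f : P.Hom x y} (hf : IsPerfectPairing f)
    (z : P.Obj) :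
    Module.finrank k ((dualRep k (zeros y)).M z) ≤ Module.finrank k ((proj P k x).M z) := by
  classical
  have := (finDim_proj (k := k) x).1 z
  have := Fintype.ofFinite {h : P.Hom z y // h ≠ P.zero z y}
  have := Fintype.ofFinite {g : P.Hom x z // g ≠ P.zero x z}
  let a : (dualRep k (zeros y)).M z →ₗ[k] ({h : P.Hom z y // h ≠ P.zero z y} → k) :=
    (LinearMap.funLeft k k Subtype.val).comp (Submodule.subtype _)
  have ha : Function.Injective a := by
    intro φ ψ h
    refine Subtype.ext (funext fun t => ?_)
    by_cases ht : t = P.zero z y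
    · rw [φ.2 t ht, ψ.2 t ht]
    · exact congrFun h ⟨t, ht⟩
  let b : (proj P k x).M z →ₗ[k] ({g : P.Hom x z // g ≠ P.zero x z} → k) :=
    LinearMap.pi fun g => coeff k g.1 g.2
  have hb : Function.Surjective b := by
    intro c
    refine ⟨∑ g, c g • basisVec k g.1, funext fun g => ?_⟩
    change coeff k g.1 g.2 _ = _
    rw [map_sum, Finset.sum_eq_single g]
    · rw [map_smul, coeff_basisVec, if_pos rfl, smul_eq_mul, mul_one]
    · intro g' _ hg'
      rw [map_smul, coeff_basisVec, if_neg fun h => hg' (Subtype.ext h), smul_zero]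
    · exact fun h => absurd (Finset.mem_univ g) h
  calc _ ≤ Module.finrank k ({h : P.Hom z y // h ≠ P.zero z y} → k) :=
        LinearMap.finrank_le_finrank_of_injective ha
    _ ≤ Module.finrank k ({g : P.Hom x z // g ≠ P.zero x z} → k) := by
        rw [Module.finrank_fintype_fun_eq_card, Module.finrank_fintype_fun_eq_card,
          ← Nat.card_eq_fintype_card, ← Nat.card_eq_fintype_card]
        exact hf.card_le z
    _ ≤ _ := LinearMap.finrank_le_finrank_of_surjective hb

/-- every nonzero element of the projective module is mapped to a nonzero multiple of `f` -/
theorem exists_act_eq_smul {x y : P.Obj} {f : P.Hom x y} (hf : IsPerfectPairing f) {z : P.Obj}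
    (v : (proj P k x).M z) (hv : v ≠ 0) :
    ∃ (h : P.Hom z y) (c : k), c ≠ 0 ∧ (proj P k x).act h v = c • basisVec k f := by
  classical
  obtain ⟨a, rfl⟩ := Submodule.Quotient.mk_surjective _ v
  have hz : ∀ w, basisVec k (P.zero x w) = 0 := fun w =>
    (Submodule.Quotient.mk_eq_zero _).2 (Submodule.mem_span_singleton_self _)
  have hsum : (Submodule.Quotient.mk a : (proj P k x).M z) =
      ∑ g ∈ a.support, a g • basisVec k g := by
    have h1 : a = ∑ g ∈ a.support, a g • Finsupp.single g (1 : k) := by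
      conv_lhs => rw [← a.sum_single]
      exact Finset.sum_congr rfl fun g _ => by rw [Finsupp.smul_single_one]
    conv_lhs => rw [h1]
    exact map_sum (Submodule.mkQ _) _ _
  let T := a.support.filter fun g => g ≠ P.zero x z
  have hT : T.Nonempty := by
    rw [Finset.nonempty_iff_ne_empty]
    intro hT
    apply hv
    rw [hsum]
    refine Finset.sum_eq_zero fun g hg => ?_
    have : g = P.zero x z := by
      by_contra h
      exact (Finset.eq_empty_iff_forall_notMem.1 hT) g (Finset.mem_filter.2 ⟨hg, h⟩)
    rw [this, hz, smul_zero]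
  obtain ⟨g, hg, h, hh, hother⟩ := hf.exists_isolating T hT fun g hg => (Finset.mem_filter.1 hg).2
  refine ⟨h, a g, Finsupp.mem_support_iff.1 (Finset.mem_filter.1 hg).1, ?_⟩
  rw [hsum, map_sum, Finset.sum_eq_single g]
  · rw [map_smul, act_basisVec, hh]
  · intro g' hg' hne
    rw [map_smul, act_basisVec]
    by_cases h0 : g' = P.zero x z
    · rw [h0, P.comp_zero, hz, smul_zero]
    · rw [hother g' (Finset.mem_filter.2 ⟨hg', h0⟩) hne, hz, smul_zero]
  · exact fun h => absurd (Finset.mem_filter.1 hg).1 h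

theorem rModIso_proj_of_act_ne_zero {x y : P.Obj} {f : P.Hom x y} (hf : IsPerfectPairing f)
    (N : FMod P k) (hN : N.Indec) (hact : N.act f ≠ 0) : RModIso (proj P k x) N := by
  obtain ⟨n, hn⟩ : ∃ n, N.act f n ≠ 0 := by
    by_contra! h
    exact hact (LinearMap.ext h)
  obtain ⟨ξ, hξ⟩ := exists_form (k := k) hn
  let α := ofElem N n
  let β : RModHom N (dualRep k (zeros y)) := toDual N ξ (by
    rintro z u rfl n
    rw [act_zero_apply, map_zero])
  have hinj : ∀ z, Function.Injective ((β.comp α).app z) := by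
    intro z
    rw [injective_iff_map_eq_zero]
    intro v hv
    by_contra hv0
    obtain ⟨h, c, hc, hcv⟩ := exists_act_eq_smul hf v hv0
    apply hc
    have h1 : ((β.app z (α.app z v)).1 h : k) = 0 := congrFun (congrArg Subtype.val hv) h
    rw [toDual_apply, ← RModHom.app_act, hcv, map_smul, ofElem_basisVec, map_smul, hξ,
      smul_eq_mul, mul_one] at h1
    exact h1
  have hbij : ∀ z, Function.Bijective ((β.comp α).app z) := by
    intro z
    have := (finDim_proj (k := k) x).1 z
    have := (finDim_dualRep (k := k) (V := zeros y)).1 z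
    refine ⟨hinj z, ?_⟩
    exact (LinearMap.injective_iff_surjective_of_finrank_eq_finrank
      (le_antisymm (LinearMap.finrank_le_finrank_of_injective (hinj z))
        (finrank_dualRep_le hf z))).1 (hinj z)
  let γ := (β.comp α).inv hbij
  have hγ : ∀ z v, γ.app z (β.app z (α.app z v)) = v := fun z v =>
    RModHom.inv_app_app (β.comp α) hbij z v
  have hαinj : ∀ z, Function.Injective (α.app z) := fun z a b hab => by
    rw [← hγ z a, hab, hγ]
  refine ⟨α, fun z => ⟨hαinj z, fun m => ?_⟩⟩
  rcases hN.2 (α.comp (γ.comp β)) (fun w => LinearMap.ext fun a => by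
    change α.app w (γ.app w (β.app w (α.app w (γ.app w (β.app w a))))) =
      α.app w (γ.app w (β.app w a))
    rw [hγ]) with h0 | h1
  · exfalso
    have h2 : α.app y (γ.app y (β.app y (α.app y (basisVec k f)))) = 0 :=
      LinearMap.congr_fun (h0 y) (α.app y (basisVec k f))
    rw [hγ, ofElem_basisVec] at h2
    exact hn h2
  · exact ⟨γ.app z (β.app z m), LinearMap.congr_fun (h1 z) m⟩

end FMod

/-- the ideal generated by a morphism -/
def RIdeal.generatedBy {P : RayCategory} {a b : P.Obj} (f : P.Hom a b) : RIdeal P where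
  mem := IdealOf P f
  zero_mem s t := ⟨P.zero b t, P.zero s a, by rw [P.zero_comp]⟩
  comp_mem_left := by
    rintro s t r g _ ⟨u, v, rfl⟩
    exact ⟨P.comp g u, v, by rw [P.assoc]⟩
  comp_mem_right := by
    rintro s t r _ g ⟨u, v, rfl⟩
    exact ⟨u, P.comp v g, by simp only [P.assoc]⟩

namespace RMod

variable {P : RayCategory} {k : Type} [Field k] {D : Set P.Obj}
  {I : ∀ a b : P.Obj, P.Hom a b → Prop}

/-- replace the ideal by another one annihilating the module -/
def changeIdeal (M : RMod P k D I) (J : ∀ a b : P.Obj, P.Hom a b → Prop)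
    (hJ : ∀ a b (f : P.Hom a b), J a b f → M.act f = 0) : RMod P k D J where
  M := M.M
  act := M.act
  act_id := M.act_id
  act_comp := M.act_comp
  act_zero := M.act_zero
  supp := M.supp
  killed f hf := hJ _ _ f hf

end RMod

theorem locRepFin_of_isPerfectPairing {P : RayCategory} {x y : P.Obj} {f : P.Hom x y}
    (hf : RayCategory.IsPerfectPairing f)
    (hfin : RepFin P Set.univ (RIdeal.generatedBy f).mem) : LocRepFin P := by
  intro k _ z
  obtain ⟨ι, _, rep, hrep⟩ := hfin k z
  refine ⟨Option ι, inferInstance, fun i => i.elim (FMod.proj P k x)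
    fun i => (rep i).changeIdeal _ fun _ _ _ h => h.elim, fun N hN hind hz => ?_⟩
  by_cases hact : N.act f = 0
  · obtain ⟨i, φ, hφ⟩ := hrep (N.changeIdeal _ (by
      rintro a b _ ⟨u, v, rfl⟩
      ext n
      rw [FMod.act_comp_apply, FMod.act_comp_apply, hact, LinearMap.zero_apply, map_zero,
        LinearMap.zero_apply])) hN
      ⟨hind.1, fun e he => hind.2 ⟨e.app, e.natural⟩ he⟩ hz
    exact ⟨some i, ⟨φ.app, φ.natural⟩, hφ⟩
  · exact ⟨none, FMod.rModIso_proj_of_act_ne_zero hf N hind hact⟩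

/-- If `P` is a minimal representation-infinite ray category, then for any field `k`
there is no nonzero finite-dimensional `k(P)`-module which is both projective and
injective. -/
theorem min_rep_inf_no_proj_inj (P : RayCategory) (h : MinRepInfinite P) :
    ∀ (k : Type) [Field k], ∀ M : FMod P k, M.FinDim →
      IsProjFD M → IsInjFD M → ¬ M.Nonzero := by
  intro k _ M _ hproj hinj hne
  obtain ⟨x, y, f, hf⟩ := FMod.exists_isPerfectPairing M hproj hinj hne
  refine h.1 (locRepFin_of_isPerfectPairing hf (h.2 _ ⟨x, y, f, hf.1, P.id y, P.id x, ?_⟩))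
  rw [P.comp_id, P.id_comp]
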